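/- Let m ≥ 1 and let u, v¹, …, vᵐ : ℝ² → ℝ be a smooth solution of the system (W) with v^k ≠ 0 everywhere and v^i ≠ v^j everywhere for i ≠ j. Let C(x,t) = A + B be the (m+1)×(m+1) matrix with entries α_{11} = u_x, α_{1(j+1)} = v^j_x·(v^j)^{−1}, α_{(j+1)1} = v^j_x, α_{(j+1)(j+1)} = u_x − v^j_x, α_{(i+1)(j+1)} = 0 for i ≠ j, β_{(j+1)(j+1)} = Σ_{k≠j} (v^k_x − v^k·v^j_x·(v^j)^{−1})/(v^k − v^j), β_{(i+1)(j+1)} = (v^i_x − v^i·v^j_x·(v^j)^{−1})/(v^j − v^i) for i ≠ j, and β_{11} = β_{1(j+1)} = β_{(j+1)1} = 0. For a fixed t, define the linearization operator D_K acting on smooth maps w : ℝ → ℝ^{m+1} by (D_K w)₁ = u_x·w₁ + u·w₁′ + Σ_{k=1}^m (w_{k+1})′ and (D_K w)_{j+1} = v^j_x·w₁ + v^j·w₁′ + (u_x − v^j_x)·w_{j+1} + (u − v^j)·(w_{j+1})′ for j = 1, …, m, where ′ denotes d/dx. Then for every smooth compactly supported φ : ℝ → ℝ^{m+1}, every t,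 and every x, with Φ(x) = ∫_{−∞}^x φ(y) dy: (∂_t C)(x,t)·Φ(x) = [D_K( y ↦ C(y,t)·Φ(y) )](x) − C(x,t)·∫_{−∞}^x (D_K φ)(y) dy. That is, the recursion operator R = C·∂_x^{−1} satisfies the recursion operator criterion R_t = D_K∘R − R∘D_K along solutions of (W). -/

import Mathlib

open MeasureTheory

/-- Partial derivative with respect to the first (space) variable. -/
noncomputable def pdx (f : ℝ → ℝ → ℝ) (x t : ℝ) : ℝ := deriv (fun y => f y t) x

/-- Partial derivative with respect to the second (time) variable. -/
noncomputable def pdt (f : ℝ → ℝ → ℝ) (x t : ℝ) : ℝ := deriv (fun s => f x s) t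

/-- The `(m+1)×(m+1)` matrix `C = A + B` of the recursion operator
`R = C ∂_x⁻¹`, with the values `Ux = u_x`, `V j = v^j`, `Vx j = v^j_x`
at a given point; index `0` corresponds to `u` and `j.succ` to `v^j`. -/
noncomputable def cMat (m : ℕ) (Ux : ℝ) (V Vx : Fin m → ℝ)
    (r c : Fin (m + 1)) : ℝ :=
  if hr : r = 0 then
    if hc : c = 0 then Ux
    else Vx (c.pred hc) / V (c.pred hc)
  else
    if hc : c = 0 then Vx (r.pred hr)
    else
      if r.pred hr = c.pred hc then
        (Ux - Vx (r.pred hr)) +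
          ∑ k : Fin m, (if k = r.pred hr then 0 else
            (Vx k - V k * Vx (r.pred hr) / V (r.pred hr)) / (V k - V (r.pred hr)))
      else
        (Vx (r.pred hr) - V (r.pred hr) * Vx (c.pred hc) / V (c.pred hc)) /
          (V (c.pred hc) - V (r.pred hr))

/-- The matrix `C(x,t)` of the recursion operator attached to `u, v`. -/
noncomputable def cMatF (m : ℕ) (u : ℝ → ℝ → ℝ) (v : Fin m → ℝ → ℝ → ℝ)
    (x t : ℝ) : Fin (m + 1) → Fin (m + 1) → ℝ :=
  cMat m (pdx u x t) (fun k => v k x t) (fun k => pdx (v k) x t)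

/-- The linearization (Fréchet derivative) `D_K` of the right-hand side of
the system (W) at time `t`, acting on maps `w : ℝ → ℝ^{m+1}`. -/
noncomputable def DK (m : ℕ) (u : ℝ → ℝ → ℝ) (v : Fin m → ℝ → ℝ → ℝ)
    (t : ℝ) (w : ℝ → Fin (m + 1) → ℝ) (x : ℝ) (r : Fin (m + 1)) : ℝ :=
  if hr : r = 0 then
    pdx u x t * w x 0 + u x t * deriv (fun y => w y 0) x +
      ∑ k : Fin m, deriv (fun y => w y k.succ) x
  else
    pdx (v (r.pred hr)) x t * w x 0 + v (r.pred hr) x t * deriv (fun y => w y 0) x +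
      (pdx u x t - pdx (v (r.pred hr)) x t) * w x r +
      (u x t - v (r.pred hr) x t) * deriv (fun y => w y r) x

section Algebra

variable {m : ℕ}

/-- The matrix `M` with `D_K = ∂_x ∘ M`, acting on a vector `w`. -/
def fluxAct (U : ℝ) (V : Fin m → ℝ) (w : Fin (m + 1) → ℝ) : Fin (m + 1) → ℝ :=
  Fin.cons (U * w 0 + ∑ k : Fin m, w k.succ)
    (fun i => V i * w 0 + (U - V i) * w i.succ)

@[simp] lemma fluxAct_zero (U : ℝ) (V : Fin m → ℝ) (w : Fin (m + 1) → ℝ) :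
    fluxAct U V w 0 = U * w 0 + ∑ k : Fin m, w k.succ := rfl

@[simp] lemma fluxAct_succ (U : ℝ) (V : Fin m → ℝ) (w : Fin (m + 1) → ℝ) (i : Fin m) :
    fluxAct U V w i.succ = V i * w 0 + (U - V i) * w i.succ := rfl

/-- A potential whose derivative along any curve is `cMat`. -/
noncomputable def cPot (U : ℝ) (V : Fin m → ℝ) (r c : Fin (m + 1)) : ℝ :=
  Fin.cases (Fin.cases U (fun j => Real.log (V j)) c)
    (fun i => Fin.cases (V i)
      (fun j => if i = j then
          U - V i - ∑ k : Fin m, (if k = i then 0 else Real.log (V i) - Real.log (V i - V k))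
        else Real.log (V j) - Real.log (V j - V i)) c) r

@[simp] lemma cMat_zero_zero (Ux : ℝ) (V Vx : Fin m → ℝ) : cMat m Ux V Vx 0 0 = Ux := by
  simp [cMat]

@[simp] lemma cMat_zero_succ (Ux : ℝ) (V Vx : Fin m → ℝ) (j : Fin m) :
    cMat m Ux V Vx 0 j.succ = Vx j / V j := by
  simp [cMat]

@[simp] lemma cMat_succ_zero (Ux : ℝ) (V Vx : Fin m → ℝ) (i : Fin m) :
    cMat m Ux V Vx i.succ 0 = Vx i := by
  simp [cMat]

lemma cMat_succ_succ_self (Ux : ℝ) (V Vx : Fin m → ℝ) (i : Fin m) :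
    cMat m Ux V Vx i.succ i.succ = (Ux - Vx i) +
      ∑ k : Fin m, (if k = i then 0 else (Vx k - V k * Vx i / V i) / (V k - V i)) := by
  simp [cMat]

lemma cMat_succ_succ_ne (Ux : ℝ) (V Vx : Fin m → ℝ) {i j : Fin m} (h : i ≠ j) :
    cMat m Ux V Vx i.succ j.succ = (Vx i - V i * Vx j / V j) / (V j - V i) := by
  simp [cMat, h]

lemma cMat_column_sum (Ux : ℝ) (V Vx : Fin m → ℝ) (j : Fin m) :
    ∑ i : Fin m, cMat m Ux V Vx i.succ j.succ = Ux - Vx j := by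
  have h : ∀ i : Fin m, cMat m Ux V Vx i.succ j.succ =
      (if i = j then cMat m Ux V Vx j.succ j.succ else 0) -
        (if i = j then 0 else (Vx i - V i * Vx j / V j) / (V i - V j)) := by
    intro i
    by_cases hij : i = j
    · simp [hij]
    · rw [cMat_succ_succ_ne _ _ _ hij, if_neg hij, if_neg hij, ← neg_sub (V i) (V j), div_neg]
      ring
  rw [Finset.sum_congr rfl fun i _ => h i, Finset.sum_sub_distrib]
  simp [cMat_succ_succ_self]

lemma cMat_mul_sub (Ux : ℝ) {V Vx : Fin m → ℝ} (hV : ∀ i, V i ≠ 0)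
    (hne : ∀ i j, i ≠ j → V i ≠ V j) (i j : Fin m) :
    cMat m Ux V Vx i.succ j.succ * (V j - V i) = Vx i - V i * (Vx j / V j) := by
  by_cases hij : i = j
  · subst hij
    have := hV i
    field_simp
    ring
  · rw [cMat_succ_succ_ne _ _ _ hij, div_mul_cancel₀ _ (sub_ne_zero.2 (hne j i (Ne.symm hij))),
      mul_div_assoc]

lemma cMat_row_sum (Ux : ℝ) {V Vx : Fin m → ℝ} (hV : ∀ i, V i ≠ 0)
    (hne : ∀ i j, i ≠ j → V i ≠ V j) (i : Fin m) :
    ∑ j : Fin m, cMat m Ux V Vx i.succ j.succ * V j = V i * (Ux - Vx i) := by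
  have h : ∀ j : Fin m, cMat m Ux V Vx i.succ j.succ * V j =
      (if j = i then cMat m Ux V Vx i.succ i.succ * V i else 0) -
        V i * (if j = i then 0 else (Vx j - V j * Vx i / V i) / (V j - V i)) := by
    intro j
    by_cases hij : j = i
    · simp [hij]
    · rw [cMat_succ_succ_ne _ _ _ (Ne.symm hij), if_neg hij, if_neg hij]
      have := hV i
      have := hV j
      have := sub_ne_zero.2 (hne j i hij)
      field_simp
      ring
  rw [Finset.sum_congr rfl fun j _ => h j, Finset.sum_sub_distrib, ← Finset.mul_sum]
  simp [cMat_succ_succ_self]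
  ring

/-- The matrices `M` and `C` commute. -/
lemma cMat_fluxAct_comm (U Ux : ℝ) {V Vx : Fin m → ℝ} (hV : ∀ i, V i ≠ 0)
    (hne : ∀ i j, i ≠ j → V i ≠ V j) (w : Fin (m + 1) → ℝ) (i : Fin (m + 1)) :
    ∑ j, cMat m Ux V Vx i j * fluxAct U V w j =
      fluxAct U V (fun i' => ∑ j, cMat m Ux V Vx i' j * w j) i := by
  refine Fin.cases ?_ (fun i => ?_) i
  · simp only [Fin.sum_univ_succ, fluxAct_zero, fluxAct_succ, cMat_zero_zero, cMat_zero_succ,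
      cMat_succ_zero, Finset.sum_add_distrib]
    rw [Finset.sum_comm]
    simp only [← Finset.sum_mul, cMat_column_sum]
    have h : ∑ j : Fin m, Vx j / V j * (V j * w 0 + (U - V j) * w j.succ) =
        (∑ j, Vx j) * w 0 + U * ∑ j : Fin m, Vx j / V j * w j.succ -
          ∑ j : Fin m, Vx j * w j.succ := by
      rw [Finset.sum_mul, Finset.mul_sum, ← Finset.sum_add_distrib, ← Finset.sum_sub_distrib]
      refine Finset.sum_congr rfl fun j _ => ?_
      have := hV j
      field_simp
      ring
    rw [h]
    simp only [sub_mul, Finset.sum_sub_distrib, ← Finset.mul_sum]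
    ring
  · simp only [Fin.sum_univ_succ, fluxAct_zero, fluxAct_succ, cMat_zero_zero, cMat_zero_succ,
      cMat_succ_zero]
    have h : ∑ j : Fin m, cMat m Ux V Vx i.succ j.succ * (V j * w 0 + (U - V j) * w j.succ) =
        (∑ j : Fin m, cMat m Ux V Vx i.succ j.succ * V j) * w 0 +
          (U - V i) * ∑ j : Fin m, cMat m Ux V Vx i.succ j.succ * w j.succ -
          Vx i * (∑ j : Fin m, w j.succ) + V i * ∑ j : Fin m, Vx j / V j * w j.succ := by
      simp only [Finset.sum_mul, Finset.mul_sum]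
      rw [← Finset.sum_add_distrib, ← Finset.sum_sub_distrib, ← Finset.sum_add_distrib]
      refine Finset.sum_congr rfl fun j _ => ?_
      linear_combination (-w j.succ) * cMat_mul_sub Ux (Vx := Vx) hV hne i j
    rw [h, cMat_row_sum Ux hV hne]
    ring

/-- Replacing `x`-derivatives by the `t`-derivatives prescribed by (W) turns `C` into `M C`. -/
lemma cMat_evolution (U Ux : ℝ) {V Vx : Fin m → ℝ} (hV : ∀ i, V i ≠ 0)
    (hne : ∀ i j, i ≠ j → V i ≠ V j) (i j : Fin (m + 1)) :
    cMat m (U * Ux + ∑ k, Vx k) V (fun k => V k * Ux + (U - V k) * Vx k) i j =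
      fluxAct U V (fun i' => cMat m Ux V Vx i' j) i := by
  refine Fin.cases ?_ (fun i => ?_) i <;> refine Fin.cases ?_ (fun j => ?_) j
  · simp
  · simp only [cMat_zero_succ, fluxAct_zero, cMat_column_sum]
    have := hV j
    field_simp
    ring
  · simp
  · simp only [fluxAct_succ, cMat_zero_succ]
    by_cases hij : i = j
    · subst hij
      have h0 := hV i
      rw [cMat_succ_succ_self, cMat_succ_succ_self]
      have h : ∀ k, (if k = i then 0 else
          (V k * Ux + (U - V k) * Vx k - V k * (V i * Ux + (U - V i) * Vx i) / V i) /
            (V k - V i)) =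
          (U - V i) * (if k = i then 0 else (Vx k - V k * Vx i / V i) / (V k - V i)) - Vx k +
            (if k = i then Vx i else 0) := by
        intro k
        by_cases hk : k = i
        · simp [hk]
        · simp only [if_neg hk]
          have := sub_ne_zero.2 (hne k i hk)
          field_simp
          ring
      rw [Finset.sum_congr rfl fun k _ => h k, Finset.sum_add_distrib, Finset.sum_sub_distrib,
        ← Finset.mul_sum, Finset.sum_ite_eq' Finset.univ i, if_pos (Finset.mem_univ i)]
      field_simp
      ring
    · rw [cMat_succ_succ_ne _ _ _ hij, cMat_succ_succ_ne _ _ _ hij]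
      have := hV j
      have := sub_ne_zero.2 (hne j i (Ne.symm hij))
      field_simp
      ring

end Algebra

section Calculus

variable {m : ℕ}

lemma hasDerivAt_cPot {a : ℝ → ℝ} {b : Fin m → ℝ → ℝ} {a' s : ℝ} {b' : Fin m → ℝ}
    (ha : HasDerivAt a a' s) (hb : ∀ k, HasDerivAt (b k) (b' k) s)
    (hV : ∀ i, b i s ≠ 0) (hne : ∀ i j, i ≠ j → b i s ≠ b j s) (i j : Fin (m + 1)) :
    HasDerivAt (fun y => cPot (a y) (fun k => b k y) i j)
      (cMat m a' (fun k => b k s) b' i j) s := by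
  have hlog : ∀ i j, i ≠ j → HasDerivAt (fun y => Real.log (b j y) - Real.log (b j y - b i y))
      ((b' i - b i s * b' j / b j s) / (b j s - b i s)) s := by
    intro i j hij
    have h := sub_ne_zero.2 (hne j i (Ne.symm hij))
    refine (((hb j).log (hV j)).fun_sub (((hb j).fun_sub (hb i)).log h)).congr_deriv ?_
    have := hV j
    field_simp
    ring
  refine Fin.cases ?_ (fun i => ?_) i <;> refine Fin.cases ?_ (fun j => ?_) j
  · simpa [cPot] using ha
  · simpa [cPot] using (hb j).log (hV j)
  · simpa [cPot] using hb i
  · by_cases hij : i = j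
    · subst hij
      rw [cMat_succ_succ_self]
      simp only [cPot, Fin.cases_succ, if_true]
      rw [← sub_neg_eq_add, ← Finset.sum_neg_distrib]
      refine (ha.sub (hb i)).sub (HasDerivAt.fun_sum fun k _ => ?_)
      by_cases hk : k = i
      · simpa [hk] using hasDerivAt_const s (0 : ℝ)
      · simp only [if_neg hk]
        refine (hlog k i hk).congr_deriv ?_
        rw [← div_neg, neg_sub]
    · rw [cMat_succ_succ_ne _ _ _ hij]
      simpa [cPot, hij] using hlog i j hij

lemma contDiff_cPot {E : Type*} [NormedAddCommGroup E] [NormedSpace ℝ E] {n : WithTop ℕ∞}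
    {a : E → ℝ} {b : Fin m → E → ℝ} (ha : ContDiff ℝ n a) (hb : ∀ k, ContDiff ℝ n (b k))
    (hV : ∀ i q, b i q ≠ 0) (hne : ∀ i j, i ≠ j → ∀ q, b i q ≠ b j q) (i j : Fin (m + 1)) :
    ContDiff ℝ n (fun q => cPot (a q) (fun k => b k q) i j) := by
  have hlog : ∀ i j, i ≠ j →
      ContDiff ℝ n (fun q => Real.log (b j q) - Real.log (b j q - b i q)) := fun i j hij =>
    ((hb j).log (hV j)).sub
      (((hb j).sub (hb i)).log fun q => sub_ne_zero.2 (hne j i (Ne.symm hij) q))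
  refine Fin.cases ?_ (fun i => ?_) i <;> refine Fin.cases ?_ (fun j => ?_) j
  · simpa [cPot] using ha
  · simpa [cPot] using (hb j).log (hV j)
  · simpa [cPot] using hb i
  · by_cases hij : i = j
    · subst hij
      simp only [cPot, Fin.cases_succ, if_true]
      refine (ha.sub (hb i)).sub (ContDiff.sum fun k _ => ?_)
      by_cases hk : k = i
      · simpa [hk] using contDiff_const
      · simpa only [if_neg hk] using hlog k i hk
    · simpa [cPot, hij] using hlog i j hij

lemma hasDerivAt_fluxAct {a : ℝ → ℝ} {b : Fin m → ℝ → ℝ} {w : ℝ → Fin (m + 1) → ℝ}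
    {a' s : ℝ} {b' : Fin m → ℝ} {w' : Fin (m + 1) → ℝ}
    (ha : HasDerivAt a a' s) (hb : ∀ k, HasDerivAt (b k) (b' k) s)
    (hw : ∀ i, HasDerivAt (fun y => w y i) (w' i) s) (i : Fin (m + 1)) :
    HasDerivAt (fun y => fluxAct (a y) (fun k => b k y) (w y) i)
      ((Fin.cons (a' * w s 0 + a s * w' 0 + ∑ k : Fin m, w' k.succ)
        (fun i => b' i * w s 0 + b i s * w' 0 + ((a' - b' i) * w s i.succ +
          (a s - b i s) * w' i.succ)) : Fin (m + 1) → ℝ) i) s := by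
  refine Fin.cases ?_ (fun i => ?_) i
  · exact (ha.mul (hw 0)).add (HasDerivAt.fun_sum fun k _ => hw k.succ)
  · exact ((hb i).mul (hw 0)).add ((ha.sub (hb i)).mul (hw i.succ))

lemma hasDerivAt_pdx {f : ℝ → ℝ → ℝ} (hf : Differentiable ℝ (fun q : ℝ × ℝ => f q.1 q.2))
    (x t : ℝ) : HasDerivAt (fun y => f y t) (pdx f x t) x := by
  have : Differentiable ℝ (fun y => f y t) :=
    hf.comp (differentiable_id.prodMk (differentiable_const t))
  exact (this x).hasDerivAt

lemma hasDerivAt_pdt {f : ℝ → ℝ → ℝ} (hf : Differentiable ℝ (fun q : ℝ × ℝ => f q.1 q.2))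
    (x t : ℝ) : HasDerivAt (fun s => f x s) (pdt f x t) t := by
  have : Differentiable ℝ (fun s => f x s) :=
    hf.comp ((differentiable_const x).prodMk differentiable_id)
  exact (this t).hasDerivAt

lemma pdx_eq_fderiv {f : ℝ → ℝ → ℝ} (hf : Differentiable ℝ (fun q : ℝ × ℝ => f q.1 q.2))
    (x t : ℝ) : pdx f x t = fderiv ℝ (fun q : ℝ × ℝ => f q.1 q.2) (x, t) (1, 0) :=
  (HasFDerivAt.comp_hasDerivAt (f := fun y => (y, t)) x (hf (x, t)).hasFDerivAt
    ((hasDerivAt_id x).prodMk (hasDerivAt_const x t))).deriv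

lemma pdt_eq_fderiv {f : ℝ → ℝ → ℝ} (hf : Differentiable ℝ (fun q : ℝ × ℝ => f q.1 q.2))
    (x t : ℝ) : pdt f x t = fderiv ℝ (fun q : ℝ × ℝ => f q.1 q.2) (x, t) (0, 1) :=
  (HasFDerivAt.comp_hasDerivAt (f := fun s => (x, s)) t (hf (x, t)).hasFDerivAt
    ((hasDerivAt_const t x).prodMk (hasDerivAt_id t))).deriv

lemma contDiff_pdx {f : ℝ → ℝ → ℝ} (hf : ContDiff ℝ (⊤ : ℕ∞) (fun q : ℝ × ℝ => f q.1 q.2)) :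
    ContDiff ℝ (⊤ : ℕ∞) (fun q : ℝ × ℝ => pdx f q.1 q.2) := by
  simp only [pdx_eq_fderiv (hf.differentiable (by simp))]
  exact (hf.fderiv_right (m := ((⊤ : ℕ∞) : WithTop ℕ∞)) (by simp)).clm_apply contDiff_const

lemma contDiff_pdt {f : ℝ → ℝ → ℝ} (hf : ContDiff ℝ (⊤ : ℕ∞) (fun q : ℝ × ℝ => f q.1 q.2)) :
    ContDiff ℝ (⊤ : ℕ∞) (fun q : ℝ × ℝ => pdt f q.1 q.2) := by
  simp only [pdt_eq_fderiv (hf.differentiable (by simp))]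
  exact (hf.fderiv_right (m := ((⊤ : ℕ∞) : WithTop ℕ∞)) (by simp)).clm_apply contDiff_const

/-- Symmetry of mixed partial derivatives. -/
lemma pdt_pdx_comm {f : ℝ → ℝ → ℝ} (hf : ContDiff ℝ (⊤ : ℕ∞) (fun q : ℝ × ℝ => f q.1 q.2))
    (x t : ℝ) : pdt (pdx f) x t = pdx (pdt f) x t := by
  have hd := hf.differentiable (by simp)
  have hd2 : Differentiable ℝ (fderiv ℝ (fun q : ℝ × ℝ => f q.1 q.2)) :=
    (hf.fderiv_right (m := ((⊤ : ℕ∞) : WithTop ℕ∞)) (by simp)).differentiable (by simp)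
  have hsymm := (hf.contDiffAt (x := (x, t))).isSymmSndFDerivAt (by
    simpa using (WithTop.coe_le_coe.2 le_top : ((2 : ℕ∞) : WithTop ℕ∞) ≤ ((⊤ : ℕ∞) : WithTop ℕ∞)))
  rw [pdt_eq_fderiv ((contDiff_pdx hf).differentiable (by simp)),
    pdx_eq_fderiv ((contDiff_pdt hf).differentiable (by simp))]
  simp only [pdx_eq_fderiv hd, pdt_eq_fderiv hd, Prod.mk.eta]
  rw [fderiv_clm_apply (hd2 _) (differentiableAt_const _),
    fderiv_clm_apply (hd2 _) (differentiableAt_const _)]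
  simpa using hsymm (0, 1) (1, 0)

lemma hasDerivAt_integral_Iic {f : ℝ → ℝ} (hf : Continuous f) (hi : Integrable f) (x : ℝ) :
    HasDerivAt (fun y => ∫ z in Set.Iic y, f z) (f x) x := by
  have h : (fun y => ∫ z in Set.Iic y, f z) =
      fun y => (∫ z in Set.Iic x, f z) + ∫ z in x..y, f z := by
    funext y
    rw [← intervalIntegral.integral_Iic_sub_Iic hi.integrableOn hi.integrableOn]
    ring
  rw [h]
  exact (hf.integral_hasStrictDerivAt x x).hasDerivAt.const_add _

/-- `D_K` is the `x`-derivative of the action of the flux matrix. -/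
lemma hasDerivAt_fluxAct_DK {u : ℝ → ℝ → ℝ} {v : Fin m → ℝ → ℝ → ℝ}
    (hu : Differentiable ℝ (fun q : ℝ × ℝ => u q.1 q.2))
    (hv : ∀ k, Differentiable ℝ (fun q : ℝ × ℝ => v k q.1 q.2)) (t x : ℝ)
    {w : ℝ → Fin (m + 1) → ℝ} (hw : ∀ i, DifferentiableAt ℝ (fun y => w y i) x)
    (i : Fin (m + 1)) :
    HasDerivAt (fun y => fluxAct (u y t) (fun k => v k y t) (w y) i) (DK m u v t w x i) x := by
  convert hasDerivAt_fluxAct (b := fun k y => v k y t) (hasDerivAt_pdx hu x t)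
    (fun k => hasDerivAt_pdx (hv k) x t) (fun i => (hw i).hasDerivAt) i using 1
  refine Fin.cases ?_ (fun i => ?_) i
  · simp [DK]
  · simp [DK]
    ring

lemma integral_Iic_DK {u : ℝ → ℝ → ℝ} {v : Fin m → ℝ → ℝ → ℝ}
    (hu : ContDiff ℝ (⊤ : ℕ∞) (fun q : ℝ × ℝ => u q.1 q.2))
    (hv : ∀ k, ContDiff ℝ (⊤ : ℕ∞) (fun q : ℝ × ℝ => v k q.1 q.2))
    {φ : ℝ → Fin (m + 1) → ℝ} (hφ : ContDiff ℝ (⊤ : ℕ∞) φ) (hφc : HasCompactSupport φ)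
    (t x : ℝ) (i : Fin (m + 1)) :
    ∫ y in Set.Iic x, DK m u v t φ y i = fluxAct (u x t) (fun k => v k x t) (φ x) i := by
  have hφi : ∀ i, ContDiff ℝ (⊤ : ℕ∞) (fun y => φ y i) := contDiff_pi.1 hφ
  have hline : ContDiff ℝ (⊤ : ℕ∞) (fun y : ℝ => (y, t)) := contDiff_id.prodMk contDiff_const
  have hut : ContDiff ℝ (⊤ : ℕ∞) (fun y => u y t) := hu.comp hline
  have hvt : ∀ k, ContDiff ℝ (⊤ : ℕ∞) (fun y => v k y t) := fun k => (hv k).comp hline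
  have hsmooth : ContDiff ℝ (⊤ : ℕ∞)
      (fun y => fluxAct (u y t) (fun k => v k y t) (φ y) i) := by
    refine Fin.cases ?_ (fun i => ?_) i
    · exact (hut.mul (hφi 0)).add (ContDiff.sum fun k _ => hφi k.succ)
    · exact ((hvt i).mul (hφi 0)).add ((hut.sub (hvt i)).mul (hφi i.succ))
  have hcompact : HasCompactSupport
      (fun y => fluxAct (u y t) (fun k => v k y t) (φ y) i) := by
    refine hφc.mono fun y hy => ?_
    contrapose! hy
    rw [Function.notMem_support] at hy ⊢
    rw [hy]
    refine Fin.cases ?_ (fun i => ?_) i <;> simp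
  have hderiv : ∀ y, DK m u v t φ y i =
      deriv (fun y => fluxAct (u y t) (fun k => v k y t) (φ y) i) y := fun y =>
    (hasDerivAt_fluxAct_DK (hu.differentiable (by simp))
      (fun k => (hv k).differentiable (by simp)) t y
      (fun i => ((hφi i).differentiable (by simp)) y) i).deriv.symm
  simp only [hderiv]
  exact hcompact.integral_Iic_deriv_eq (hsmooth.of_le (by simp)) x

end Calculus

/-- along solutions of the system (W), the recursion operator
`R = C ∂_x⁻¹` satisfies the recursion-operator criterion
`R_t = D_K ∘ R - R ∘ D_K`, tested against smooth compactly supported `φ`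
with `Φ(x) = ∫_{-∞}^x φ(y) dy`. -/
theorem statement12 (m : ℕ) (hm : 1 ≤ m)
    (u : ℝ → ℝ → ℝ) (v : Fin m → ℝ → ℝ → ℝ)
    (hu : ContDiff ℝ (⊤ : ℕ∞) (fun q : ℝ × ℝ => u q.1 q.2))
    (hv : ∀ k, ContDiff ℝ (⊤ : ℕ∞) (fun q : ℝ × ℝ => v k q.1 q.2))
    (hvne : ∀ k x t, v k x t ≠ 0)
    (hvij : ∀ i j, i ≠ j → ∀ x t, v i x t ≠ v j x t)
    (hsolu : ∀ x t, pdt u x t = u x t * pdx u x t + ∑ k : Fin m, pdx (v k) x t)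
    (hsolv : ∀ (k : Fin m) (x t : ℝ), pdt (v k) x t =
      v k x t * pdx u x t + (u x t - v k x t) * pdx (v k) x t)
    (φ : ℝ → Fin (m + 1) → ℝ)
    (hφ : ContDiff ℝ (⊤ : ℕ∞) φ) (hφc : HasCompactSupport φ) :
    ∀ (t x : ℝ) (i : Fin (m + 1)),
      (∑ j : Fin (m + 1),
          pdt (fun x' t' => cMatF m u v x' t' i j) x t *
            ∫ y in Set.Iic x, φ y j) =
        DK m u v t
            (fun y i' => ∑ j : Fin (m + 1), cMatF m u v y t i' j *
              ∫ z in Set.Iic y, φ z j) x i -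
          ∑ j : Fin (m + 1), cMatF m u v x t i j *
            ∫ y in Set.Iic x, DK m u v t φ y j := by
  intro t x i
  have hud := hu.differentiable (by simp)
  have hvd := fun k => (hv k).differentiable (by simp)
  have hpot : ∀ i j, ContDiff ℝ (⊤ : ℕ∞)
      (fun q : ℝ × ℝ => cPot (u q.1 q.2) (fun k => v k q.1 q.2) i j) :=
    contDiff_cPot hu hv (fun k q => hvne k q.1 q.2) (fun k l h q => hvij k l h q.1 q.2)
  have hpdx : ∀ i j, (fun x t => cMatF m u v x t i j) =
      pdx (fun x t => cPot (u x t) (fun k => v k x t) i j) := fun i j => by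
    funext x t
    exact (hasDerivAt_cPot (b := fun k y => v k y t) (hasDerivAt_pdx hud x t)
      (fun k => hasDerivAt_pdx (hvd k) x t) (fun k => hvne k x t)
      (fun k l h => hvij k l h x t) i j).deriv.symm
  have hpdt : ∀ i j, pdt (fun x t => cPot (u x t) (fun k => v k x t) i j) =
      fun x t => fluxAct (u x t) (fun k => v k x t) (fun i' => cMatF m u v x t i' j) i :=
    fun i j => by
    funext x t
    have h := (hasDerivAt_cPot (b := fun k s => v k x s) (hasDerivAt_pdt hud x t)
      (fun k => hasDerivAt_pdt (hvd k) x t) (fun k => hvne k x t)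
      (fun k l h => hvij k l h x t) i j).deriv
    simp only [hsolu, hsolv] at h
    exact h.trans (cMat_evolution _ _ (fun k => hvne k x t) (fun k l h => hvij k l h x t) i j)
  have hC : ∀ i j, DifferentiableAt ℝ (fun y => cMatF m u v y t i j) x := fun i j => by
    have h := contDiff_pdx (f := fun x t => cPot (u x t) (fun k => v k x t) i j) (hpot i j)
    rw [← hpdx] at h
    exact (hasDerivAt_pdx (f := fun x t => cMatF m u v x t i j)
      (h.differentiable (by simp)) x t).differentiableAt
  have hMC : ∀ i j, HasDerivAt
      (fun y => fluxAct (u y t) (fun k => v k y t) (fun i' => cMatF m u v y t i' j) i)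
      (pdt (fun x t => cMatF m u v x t i j) x t) x := fun i j => by
    have h := contDiff_pdt (f := fun x t => cPot (u x t) (fun k => v k x t) i j) (hpot i j)
    rw [hpdx, pdt_pdx_comm (f := fun x t => cPot (u x t) (fun k => v k x t) i j) (hpot i j)]
    rw [hpdt] at h ⊢
    exact hasDerivAt_pdx (f := fun x t =>
      fluxAct (u x t) (fun k => v k x t) (fun i' => cMatF m u v x t i' j) i)
      (h.differentiable (by simp)) x t
  have hφi : ∀ j, ContDiff ℝ (⊤ : ℕ∞) (fun y => φ y j) := contDiff_pi.1 hφ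
  have hΦ : ∀ j, HasDerivAt (fun y => ∫ z in Set.Iic y, φ z j) (φ x j) x := fun j =>
    hasDerivAt_integral_Iic (hφi j).continuous ((hφi j).continuous.integrable_of_hasCompactSupport
      (hφc.comp_left (g := fun w : Fin (m + 1) → ℝ => w j) rfl)) x
  have hlin : ∀ (U : ℝ) (V : Fin m → ℝ) (A : Fin (m + 1) → Fin (m + 1) → ℝ)
      (w : Fin (m + 1) → ℝ) (i : Fin (m + 1)),
      fluxAct U V (fun i' => ∑ j, A i' j * w j) i =
        ∑ j, fluxAct U V (fun i' => A i' j) i * w j := by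
    intro U V A w i
    refine Fin.cases ?_ (fun i => ?_) i
    · simp only [fluxAct_zero, add_mul, Finset.sum_add_distrib, Finset.sum_mul, Finset.mul_sum,
        mul_assoc]
      rw [Finset.sum_comm]
    · simp only [fluxAct_succ, add_mul, Finset.sum_add_distrib, Finset.mul_sum, mul_assoc]
  have hDK := hasDerivAt_fluxAct_DK hud hvd t x
    (w := fun y i' => ∑ j, cMatF m u v y t i' j * ∫ z in Set.Iic y, φ z j)
    (fun i => DifferentiableAt.fun_sum fun j _ => (hC i j).mul (hΦ j).differentiableAt) i
  simp only [hlin] at hDK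
  have hsum := HasDerivAt.fun_sum (u := Finset.univ) fun j _ => (hMC i j).mul (hΦ j)
  rw [hDK.unique hsum, Finset.sum_add_distrib]
  simp only [integral_Iic_DK hu hv hφ hφc]
  have hcomm := cMat_fluxAct_comm (u x t) (pdx u x t) (Vx := fun k => pdx (v k) x t)
    (fun k => hvne k x t) (fun k l h => hvij k l h x t) (φ x) i
  rw [hlin] at hcomm
  simp only [cMatF] at hcomm ⊢
  rw [hcomm]
  ring
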